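/- arXiv:1109.1231 — 3 statements merged into one kernel-verified Lean document; each statement's English description precedes it below -/
import Mathlib

section
/- Let A and B be finite nonempty sets, let c : A × B → ℝ, and let β ∈ ℝ satisfy β < c(i, j) for all i ∈ A and j ∈ B. Let s be an element not in B, and extend c to c' on A × (B ∪ {s}) by c'(i, j) = c(i, j) for j ∈ B and c'(i, s) = β. Then for every subset M' ⊆ B ∪ {s} with s ∈ M' and |M'| ≥ 2, the double-coverage cost of M' under c' equals |A|·β plus the single-coverage cost of M' \ {s} under c, i.e., ∑_{i ∈ A} min_{{j₁, j₂} ⊆ M', j₁ ≠ j₂} (c'(i, j₁) + c'(i, j₂)) = |A|·β + ∑_{i ∈ A} min_{j ∈ M' \ {s}} c(i, j). -/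
/-- If `f` attains its minimum over `M` at `s`, then the cheapest pair in `M` consists of `s` and a
cheapest other element. -/
theorem Finset.inf'_powersetCard_two_sum {J : Type*} [DecidableEq J] {M : Finset J} {f : J → ℝ}
    {s : J} (hs : s ∈ M) (hf : ∀ j ∈ M, f s ≤ f j) (h₂ : (M.powersetCard 2).Nonempty)
    (h₁ : (M.erase s).Nonempty) :
    (M.powersetCard 2).inf' h₂ (fun P => ∑ j ∈ P, f j) = f s + (M.erase s).inf' h₁ f := by
  apply le_antisymm
  · obtain ⟨j, hj, hmin⟩ := Finset.exists_mem_eq_inf' h₁ f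
    obtain ⟨hjs, hjM⟩ := Finset.mem_erase.mp hj
    rw [hmin, ← Finset.sum_pair hjs.symm]
    refine Finset.inf'_le (fun P => ∑ j ∈ P, f j) (Finset.mem_powersetCard.mpr ⟨?_, ?_⟩)
    · exact Finset.insert_subset hs (Finset.singleton_subset_iff.mpr hjM)
    · exact Finset.card_pair hjs.symm
  · refine Finset.le_inf' _ _ fun P hP => ?_
    obtain ⟨hPM, hcard⟩ := Finset.mem_powersetCard.mp hP
    obtain ⟨x, y, hxy, rfl⟩ := Finset.card_eq_two.mp hcard
    have hx : x ∈ M := hPM (by simp)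
    have hy : y ∈ M := hPM (by simp)
    rw [Finset.sum_pair hxy]
    by_cases hys : y = s
    · have := Finset.inf'_le f (Finset.mem_erase.mpr ⟨hys ▸ hxy, hx⟩)
      rw [hys]
      linarith
    · have := Finset.inf'_le f (Finset.mem_erase.mpr ⟨hys, hy⟩)
      linarith [hf x hx]

/-- With `b < c(i, j)` for all `i ∈ A`, `j ∈ B`, and `c'`
extending `c` to the fresh node `s` by `c'(i, s) = b`, for every subset
`M' ⊆ B ∪ {s}` with `s ∈ M'` and `|M'| ≥ 2`, the double-coverage cost of `M'`
under `c'` (each `i ∈ A` is charged the minimum over two-element subsets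
`{j₁, j₂} ⊆ M'` of `c'(i, j₁) + c'(i, j₂)`) equals `|A|·b` plus the
single-coverage cost of `M' \ {s}` under `c`. -/
theorem double_coverage_eq_fresh_plus_single {I J : Type*} [DecidableEq J]
    (A : Finset I) (B : Finset J) (hA : A.Nonempty) (hB : B.Nonempty)
    (c : I → J → ℝ) (b : ℝ) (hb : ∀ i ∈ A, ∀ j ∈ B, b < c i j)
    (s : J) (hs : s ∉ B)
    (c' : I → J → ℝ) (hc'B : ∀ i ∈ A, ∀ j ∈ B, c' i j = c i j)
    (hc's : ∀ i ∈ A, c' i s = b) :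
    ∀ M' ⊆ insert s B, ∀ hsM' : s ∈ M', ∀ h2 : 2 ≤ M'.card,
      ∑ i ∈ A, (M'.powersetCard 2).inf'
          (Finset.powersetCard_nonempty.mpr h2)
          (fun P => ∑ j ∈ P, c' i j)
        = A.card * b +
          ∑ i ∈ A, (M'.erase s).inf'
            (Finset.card_pos.mp
              (by rw [Finset.card_erase_of_mem hsM']; omega))
            (c i) := by
  intro M' hM' hsM' h2
  rw [← nsmul_eq_mul, ← Finset.sum_const, ← Finset.sum_add_distrib]
  refine Finset.sum_congr rfl fun i hi => ?_
  have hmem : ∀ j ∈ M'.erase s, j ∈ B := fun j hj =>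
    Finset.mem_of_mem_insert_of_ne (hM' (Finset.mem_of_mem_erase hj)) (Finset.ne_of_mem_erase hj)
  have hmin : ∀ j ∈ M', c' i s ≤ c' i j := by
    intro j hj
    by_cases hjs : j = s
    · rw [hjs]
    · have hjB := hmem j (Finset.mem_erase.mpr ⟨hjs, hj⟩)
      rw [hc's i hi, hc'B i hi j hjB]
      exact (hb i hi j hjB).le
  have hne : (M'.erase s).Nonempty :=
    Finset.card_pos.mp (by rw [Finset.card_erase_of_mem hsM']; omega)
  rw [Finset.inf'_powersetCard_two_sum hsM' hmin _ hne, hc's i hi]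
  exact congrArg (b + ·) (Finset.inf'_congr hne rfl fun j hj => hc'B i hi j (hmem j hj))
end

section
/- Let A and B be finite nonempty sets, let c : A × B → ℝ, and let β ∈ ℝ satisfy β < c(i, j) for all i ∈ A and j ∈ B. Let s be an element not in B, and extend c to c' on A × (B ∪ {s}) by c'(i, j) = c(i, j) for j ∈ B and c'(i, s) = β. Then for every subset M' ⊆ B ∪ {s} with |M'| ≥ 2 and every x ∈ M', the single-coverage cost of M' \ {x} under c' satisfies ∑_{i ∈ A} min_{j ∈ M' \ {x}} c'(i, j) ≤ (∑_{i ∈ A} min_{{j₁, j₂} ⊆ M', j₁ ≠ j₂} (c'(i, j₁) + c'(i, j₂))) − |A|·β, i.e., removing any one node from a double-coverage solution yields a single-coverage cost at most the double-coverage cost minus |A|·β. -/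
/-- If `f` is bounded below by `b` on `M`, then the minimum of `f` over `M` without `x`, plus `b`,
is at most the least value of `f` summed over a two-element subset of `M`. -/
theorem inf'_erase_add_le_inf'_powersetCard_two {J : Type*} [DecidableEq J]
    {M : Finset J} {f : J → ℝ} {b : ℝ} (hf : ∀ j ∈ M, b ≤ f j) {x : J}
    (h₁ : (M.erase x).Nonempty) (h₂ : (M.powersetCard 2).Nonempty) :
    (M.erase x).inf' h₁ f + b ≤ (M.powersetCard 2).inf' h₂ (fun P => ∑ j ∈ P, f j) := by
  refine Finset.le_inf' _ _ fun P hP => ?_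
  obtain ⟨hPM, hcard⟩ := Finset.mem_powersetCard.mp hP
  obtain ⟨u, v, huv, rfl⟩ := Finset.card_eq_two.mp hcard
  have hu : u ∈ M := hPM (by simp)
  have hv : v ∈ M := hPM (by simp)
  rw [Finset.sum_pair huv]
  by_cases hux : u = x
  · have hvx : v ≠ x := fun h => huv (hux.trans h.symm)
    linarith [Finset.inf'_le f (Finset.mem_erase.mpr ⟨hvx, hv⟩), hf u hu]
  · linarith [Finset.inf'_le f (Finset.mem_erase.mpr ⟨hux, hu⟩), hf v hv]

/-- With `b < c(i, j)` for all `i ∈ A`, `j ∈ B`, and `c'`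
extending `c` to the fresh node `s` by `c'(i, s) = b`, for every subset
`M' ⊆ B ∪ {s}` with `|M'| ≥ 2` and every `x ∈ M'`, the single-coverage cost
of `M' \ {x}` under `c'` is at most the double-coverage cost of `M'` under
`c'` minus `|A|·b`. -/
theorem erase_single_coverage_le_double_coverage {I J : Type*} [DecidableEq J]
    (A : Finset I) (B : Finset J) (hA : A.Nonempty) (hB : B.Nonempty)
    (c : I → J → ℝ) (b : ℝ) (hb : ∀ i ∈ A, ∀ j ∈ B, b < c i j)
    (s : J) (hs : s ∉ B)
    (c' : I → J → ℝ) (hc'B : ∀ i ∈ A, ∀ j ∈ B, c' i j = c i j)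
    (hc's : ∀ i ∈ A, c' i s = b) :
    ∀ M' ⊆ insert s B, ∀ h2 : 2 ≤ M'.card, ∀ x, ∀ hx : x ∈ M',
      ∑ i ∈ A, (M'.erase x).inf'
          (Finset.card_pos.mp (by rw [Finset.card_erase_of_mem hx]; omega))
          (c' i)
        ≤ (∑ i ∈ A, (M'.powersetCard 2).inf'
            (Finset.powersetCard_nonempty.mpr h2)
            (fun P => ∑ j ∈ P, c' i j)) - A.card * b := by
  intro M' hM' h2 x hx
  rw [le_sub_iff_add_le, ← nsmul_eq_mul, ← Finset.sum_const, ← Finset.sum_add_distrib]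
  refine Finset.sum_le_sum fun i hi => inf'_erase_add_le_inf'_powersetCard_two (fun j hj => ?_) _ _
  rcases Finset.mem_insert.mp (hM' hj) with rfl | hjB
  · exact (hc's i hi).ge
  · exact (hc'B i hi j hjB).symm ▸ (hb i hi j hjB).le
end

section
/- Let A and B be finite nonempty sets, let c : A × B → ℝ, let φ ∈ ℝ, let k be an integer with 1 ≤ k ≤ |B|, and let β ∈ ℝ satisfy β < c(i, j) for all i ∈ A and j ∈ B. Let s be an element not in B, and extend c to c' on A × (B ∪ {s}) by c'(i, j) = c(i, j) for j ∈ B and c'(i, s) = β. If M' ⊆ B ∪ {s} satisfies |M'| = k + 1 and has double-coverage cost ∑_{i ∈ A} min_{{j₁, j₂} ⊆ M', j₁ ≠ j₂} (c'(i, j₁) + c'(i, j₂)) ≤ φ + |A|·β, then there exists M ⊆ B with |M| = k and single-coverage cost ∑_{i ∈ A} min_{j ∈ M} c(i, j) ≤ φ. -/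
/-- If every point of `M` costs at least `b`, then any two-element subset of `M` costs at least `b`
more than the cheapest point of `M.erase r`. -/
theorem add_inf'_erase_le_inf'_powersetCard_two {J : Type*} [DecidableEq J] {M : Finset J}
    {f : J → ℝ} {b : ℝ} {r : J} (hf : ∀ j ∈ M, b ≤ f j) (hM : (M.erase r).Nonempty)
    (hM2 : (M.powersetCard 2).Nonempty) :
    b + (M.erase r).inf' hM f ≤ (M.powersetCard 2).inf' hM2 (fun P => ∑ j ∈ P, f j) := by
  refine Finset.le_inf' _ _ fun P hP => ?_
  obtain ⟨hPM, hP2⟩ := Finset.mem_powersetCard.mp hP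
  obtain ⟨x, y, hxy, rfl⟩ := Finset.card_eq_two.mp hP2
  have hx : x ∈ M := hPM (by simp)
  have hy : y ∈ M := hPM (by simp)
  rw [Finset.sum_pair hxy]
  by_cases hyr : y = r
  · have hxr : x ≠ r := hyr ▸ hxy
    linarith [hf y hy, Finset.inf'_le f (Finset.mem_erase.mpr ⟨hxr, hx⟩)]
  · linarith [hf x hx, Finset.inf'_le f (Finset.mem_erase.mpr ⟨hyr, hy⟩)]

/-- With `1 ≤ k ≤ |B|`, `b < c(i, j)` for all `i ∈ A`,
`j ∈ B`, and `c'` extending `c` to the fresh node `s` by `c'(i, s) = b`, if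
`M' ⊆ B ∪ {s}` has `|M'| = k + 1` and double-coverage cost at most
`φ + |A|·b` under `c'`, then there exists `M ⊆ B` with `|M| = k` and
single-coverage cost at most `φ` under `c`. -/
theorem double_coverage_to_single_coverage {I J : Type*} [DecidableEq J]
    (A : Finset I) (B : Finset J) (hA : A.Nonempty) (hB : B.Nonempty)
    (c : I → J → ℝ) (φ : ℝ) (k : ℕ) (hk1 : 1 ≤ k) (hk2 : k ≤ B.card)
    (b : ℝ) (hb : ∀ i ∈ A, ∀ j ∈ B, b < c i j)
    (s : J) (hs : s ∉ B)
    (c' : I → J → ℝ) (hc'B : ∀ i ∈ A, ∀ j ∈ B, c' i j = c i j)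
    (hc's : ∀ i ∈ A, c' i s = b)
    (M' : Finset J) (hM'B : M' ⊆ insert s B) (hcard : M'.card = k + 1)
    (hcost : ∑ i ∈ A, (M'.powersetCard 2).inf'
        (Finset.powersetCard_nonempty.mpr (by omega))
        (fun P => ∑ j ∈ P, c' i j) ≤ φ + A.card * b) :
    ∃ M ⊆ B, ∃ hM : M.Nonempty, M.card = k ∧
      ∑ i ∈ A, M.inf' hM (c i) ≤ φ := by
  obtain ⟨r, hr, hrs⟩ : ∃ r ∈ M', s ∈ M' → r = s := by
    by_cases hsM : s ∈ M'
    · exact ⟨s, hsM, fun _ => rfl⟩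
    · obtain ⟨r, hr⟩ : M'.Nonempty := Finset.card_pos.mp (by omega)
      exact ⟨r, hr, fun h => absurd h hsM⟩
  have hMB : M'.erase r ⊆ B := by
    intro j hj
    obtain ⟨hjr, hjM⟩ := Finset.mem_erase.mp hj
    rcases Finset.mem_insert.mp (hM'B hjM) with rfl | hjB
    · exact absurd (hrs hjM).symm hjr
    · exact hjB
  have hMcard : (M'.erase r).card = k := by
    rw [Finset.card_erase_of_mem hr, hcard, Nat.add_sub_cancel]
  have hM : (M'.erase r).Nonempty := Finset.card_pos.mp (by omega)
  have hM2 : (M'.powersetCard 2).Nonempty := Finset.powersetCard_nonempty.mpr (by omega)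
  refine ⟨M'.erase r, hMB, hM, hMcard, ?_⟩
  have hle : ∑ i ∈ A, (b + (M'.erase r).inf' hM (c i)) ≤
      ∑ i ∈ A, (M'.powersetCard 2).inf' hM2 (fun P => ∑ j ∈ P, c' i j) := by
    refine Finset.sum_le_sum fun i hi => ?_
    have hlower : ∀ j ∈ M', b ≤ c' i j := by
      intro j hj
      rcases Finset.mem_insert.mp (hM'B hj) with rfl | hjB
      · exact (hc's i hi).ge
      · exact (hc'B i hi j hjB).symm ▸ (hb i hi j hjB).le
    rw [← Finset.inf'_congr hM rfl fun j hj => hc'B i hi j (hMB hj)]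
    exact add_inf'_erase_le_inf'_powersetCard_two hlower hM hM2
  rw [Finset.sum_add_distrib, Finset.sum_const, nsmul_eq_mul] at hle
  linarith
end
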